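/- Let n ≥ 2, let a_1, ..., a_n > 0, and let q(x) = Σ_{j=1}^n x_j²/a_j² − 1. For every m ≥ 0, the linear map T : P_m → P_m defined by T(r) = Δ(q·r), where P_m is the (finite-dimensional) space of real polynomials in n variables of degree at most m, is surjective: for every polynomial g of degree at most m there exists a polynomial r of degree at most m with Δ(q·r) = g. -/

import Mathlib

open MvPolynomial

namespace MvPolynomial

theorem hasDerivAt_eval_update {σ : Type*} [Fintype σ] [DecidableEq σ] (p : MvPolynomial σ ℝ)
    (x : σ → ℝ) (j : σ) (t : ℝ) :
    HasDerivAt (fun s => eval (Function.update x j s) p)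
      (eval (Function.update x j t) (pderiv j p)) t := by
  induction p using MvPolynomial.induction_on with
  | C a => simpa using hasDerivAt_const t a
  | add p q hp hq => simpa using hp.fun_add hq
  | mul_X p i hp =>
    have hX : HasDerivAt (fun s => Function.update x j s i) (Pi.single (M := fun _ => ℝ) j 1 i) t :=
      hasDerivAt_pi.1 (hasDerivAt_update x j t) i
    have hmul := hp.fun_mul hX
    rcases eq_or_ne i j with rfl | h
    · simpa [pderiv_mul, add_comm, mul_comm] using hmul
    · simpa [pderiv_mul, h, mul_comm] using hmul

theorem totalDegree_pderiv_le {σ R : Type*} [CommSemiring R] (j : σ) (p : MvPolynomial σ R) :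
    (pderiv j p).totalDegree ≤ p.totalDegree - 1 := by
  rw [totalDegree, Finset.sup_le_iff]
  intro s hs
  rw [mem_support_iff, coeff_pderiv] at hs
  have h := le_totalDegree (mem_support_iff.2 (left_ne_zero_of_mul hs))
  rw [Finsupp.sum_add_index' (fun _ => rfl) (fun _ _ _ => rfl),
    Finsupp.sum_single_index rfl] at h
  exact Nat.le_sub_of_add_le h

/-- The Laplacian on multivariate polynomials. -/
noncomputable def laplacian (σ R : Type*) [Fintype σ] [CommSemiring R] :
    MvPolynomial σ R →ₗ[R] MvPolynomial σ R :=
  ∑ j, (pderiv j).toLinearMap ∘ₗ (pderiv j).toLinearMap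

theorem laplacian_apply {σ R : Type*} [Fintype σ] [CommSemiring R] (p : MvPolynomial σ R) :
    laplacian σ R p = ∑ j, pderiv j (pderiv j p) := by
  simp [laplacian]

theorem totalDegree_laplacian_le {σ R : Type*} [Fintype σ] [CommSemiring R]
    (p : MvPolynomial σ R) : (laplacian σ R p).totalDegree ≤ p.totalDegree - 2 := by
  rw [laplacian_apply]
  refine totalDegree_finsetSum_le fun j _ => ?_
  have h₁ := totalDegree_pderiv_le j p
  have h₂ := totalDegree_pderiv_le j (pderiv j p)
  lia

end MvPolynomial

theorem IsLocalMax.deriv_deriv_nonpos {f : ℝ → ℝ} {t : ℝ} (h : IsLocalMax f t)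
    (hf : ContinuousAt f t) : deriv (deriv f) t ≤ 0 := by
  by_contra! hpos
  have hmin := isLocalMin_of_deriv_deriv_pos hpos h.deriv_eq_zero hf
  have hconst : f =ᶠ[nhds t] fun _ => f t := by
    filter_upwards [h, hmin] with s h₁ h₂ using le_antisymm h₁ h₂
  have hzero := hconst.deriv.deriv_eq
  simp at hzero
  exact hpos.ne' hzero

namespace MvPolynomial

variable {σ : Type*} [Fintype σ]

theorem eval_laplacian_nonpos_of_isLocalMax {p : MvPolynomial σ ℝ} {x : σ → ℝ}
    (h : IsLocalMax (fun y => eval y p) x) : eval x (laplacian σ ℝ p) ≤ 0 := by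
  classical
  rw [laplacian_apply, map_sum]
  refine Finset.sum_nonpos fun j _ => ?_
  have hline : IsLocalMax (fun s => eval (Function.update x j s) p) (x j) := by
    have hc : Filter.Tendsto (Function.update x j) (nhds (x j)) (nhds x) := by
      simpa using (hasDerivAt_update x j (x j)).continuousAt.tendsto
    have := hc.eventually h
    simpa [IsLocalMax, IsMaxFilter] using this
  have hd := hline.deriv_deriv_nonpos (hasDerivAt_eval_update p x j (x j)).continuousAt
  have hderiv : deriv (fun s => eval (Function.update x j s) p) =
      fun t => eval (Function.update x j t) (pderiv j p) :=
    _root_.funext fun t => (hasDerivAt_eval_update p x j t).deriv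
  rw [hderiv, (hasDerivAt_eval_update _ x j (x j)).deriv, Function.update_eq_self] at hd
  exact hd

/-- The weak maximum principle for a polynomial vanishing on the boundary of `{q ≤ 0}`. -/
theorem eval_nonneg_of_laplacian_mul_pos {q s : MvPolynomial σ ℝ}
    (hK : IsCompact {x | eval x q ≤ 0}) (hs : ∀ x, 0 < eval x (laplacian σ ℝ (q * s)))
    {x : σ → ℝ} (hx : eval x q < 0) : 0 ≤ eval x s := by
  obtain ⟨y, hy, hmax⟩ := hK.exists_isMaxOn ⟨x, hx.le⟩ (continuous_eval (q * s)).continuousOn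
  have hy0 : eval y q = 0 := by
    by_contra hne
    have hnhds : {z | eval z q ≤ 0} ∈ nhds y :=
      Filter.mem_of_superset (((isOpen_Iio (a := (0 : ℝ))).preimage (continuous_eval q)).mem_nhds
        (lt_of_le_of_ne hy hne)) fun z (hz : eval z q < 0) => hz.le
    exact (hs y).not_ge (eval_laplacian_nonpos_of_isLocalMax (hmax.isLocalMax hnhds))
  have hle : eval x (q * s) ≤ eval y (q * s) := hmax hx.le
  rw [map_mul, map_mul, hy0, zero_mul] at hle
  exact nonneg_of_mul_nonpos_right hle hx

theorem eq_zero_of_eval_eq_zero_of_isOpen {p : MvPolynomial σ ℝ} {U : Set (σ → ℝ)}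
    (hU : IsOpen U) (hne : U.Nonempty) (h : ∀ x ∈ U, eval x p = 0) : p = 0 := by
  obtain ⟨x, hx⟩ := hne
  obtain ⟨ε, hε, hball⟩ := Metric.isOpen_iff.1 hU x hx
  refine funext_set (fun j => Metric.ball (x j) ε)
    (fun j => infinite_of_mem_nhds (x j) (Metric.ball_mem_nhds _ hε)) fun y hy => ?_
  rw [map_zero]
  refine h y (hball ?_)
  rwa [ball_pi _ hε]

theorem eq_zero_of_laplacian_mul_eq_zero {q r : MvPolynomial σ ℝ}
    (hK : IsCompact {x | eval x q ≤ 0}) (hne : ∃ x, eval x q < 0)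
    (hq : ∀ x, 0 < eval x (laplacian σ ℝ q)) (hr : laplacian σ ℝ (q * r) = 0) : r = 0 := by
  have key : ∀ s, laplacian σ ℝ (q * s) = 0 → ∀ x, eval x q < 0 → 0 ≤ eval x s := by
    intro s hs x hx
    refine le_of_forall_pos_le_add fun ε hε => ?_
    have hlap : laplacian σ ℝ (q * (s + C ε)) = ε • laplacian σ ℝ q := by
      rw [mul_add, map_add, hs, zero_add, mul_comm, C_mul', map_smul]
    have := eval_nonneg_of_laplacian_mul_pos hK (s := s + C ε)
      (fun y => by rw [hlap, smul_eval]; exact mul_pos hε (hq y)) hx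
    simpa using this
  refine eq_zero_of_eval_eq_zero_of_isOpen
    ((isOpen_Iio (a := (0 : ℝ))).preimage (continuous_eval q)) hne fun x hx => ?_
  refine le_antisymm ?_ (key r hr x hx)
  have := key (-r) (by rw [mul_neg, map_neg, hr, neg_zero]) x hx
  simpa using this

theorem exists_laplacian_mul_eq {q : MvPolynomial σ ℝ} (hdeg : q.totalDegree ≤ 2)
    (hinj : ∀ r, laplacian σ ℝ (q * r) = 0 → r = 0)
    {m : ℕ} {g : MvPolynomial σ ℝ} (hg : g.totalDegree ≤ m) :
    ∃ r : MvPolynomial σ ℝ, r.totalDegree ≤ m ∧ laplacian σ ℝ (q * r) = g := by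
  let T : restrictTotalDegree σ ℝ m →ₗ[ℝ] restrictTotalDegree σ ℝ m :=
    (laplacian σ ℝ ∘ₗ LinearMap.mulLeft ℝ q).restrict fun r hr => by
      rw [mem_restrictTotalDegree] at hr ⊢
      have h₁ := totalDegree_laplacian_le (q * r)
      have h₂ := totalDegree_mul q r
      simp only [LinearMap.comp_apply, LinearMap.mulLeft_apply]
      lia
  have hT : Function.Injective T := by
    rw [← LinearMap.ker_eq_bot, LinearMap.ker_eq_bot']
    exact fun r hr => Subtype.ext (hinj r (congrArg Subtype.val hr))
  obtain ⟨r, hr⟩ := LinearMap.injective_iff_surjective.1 hT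
    ⟨g, (mem_restrictTotalDegree _ _ _).2 hg⟩
  exact ⟨r, (mem_restrictTotalDegree _ _ _).1 r.2, congrArg Subtype.val hr⟩

/-- The quadratic polynomial `∑ xⱼ² / aⱼ² - 1` defining the ellipsoid with semiaxes `a`. -/
noncomputable def ellipsoidQuadratic (a : σ → ℝ) : MvPolynomial σ ℝ :=
  (∑ j, C ((a j) ^ 2)⁻¹ * X j ^ 2) - 1

theorem eval_ellipsoidQuadratic (a x : σ → ℝ) :
    eval x (ellipsoidQuadratic a) = ∑ j, ((a j) ^ 2)⁻¹ * x j ^ 2 - 1 := by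
  simp [ellipsoidQuadratic]

theorem totalDegree_ellipsoidQuadratic_le (a : σ → ℝ) :
    (ellipsoidQuadratic a).totalDegree ≤ 2 := by
  refine (totalDegree_sub _ _).trans (max_le (totalDegree_finsetSum_le fun j _ => ?_) (by simp))
  refine (totalDegree_mul _ _).trans ?_
  rw [totalDegree_C, totalDegree_X_pow]

theorem laplacian_ellipsoidQuadratic (a : σ → ℝ) :
    laplacian σ ℝ (ellipsoidQuadratic a) = C (∑ j, 2 * ((a j) ^ 2)⁻¹) := by
  classical
  have hfirst (j : σ) : pderiv j (ellipsoidQuadratic a) = C (2 * ((a j) ^ 2)⁻¹) * X j := by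
    rw [ellipsoidQuadratic, map_sub, map_sum, pderiv_one, sub_zero, Finset.sum_eq_single j]
    · rw [pderiv_C_mul, pderiv_pow, pderiv_X_self, C_mul]
      simp only [Nat.cast_ofNat, Nat.add_one_sub_one, pow_one, mul_one, map_ofNat]
      ring
    · intro i _ hij
      rw [pderiv_C_mul, pderiv_pow, pderiv_X_of_ne hij, mul_zero, mul_zero]
    · simp
  rw [laplacian_apply, map_sum]
  refine Finset.sum_congr rfl fun j _ => ?_
  rw [hfirst, pderiv_C_mul, pderiv_X_self, mul_one]

theorem isCompact_ellipsoid {a : σ → ℝ} (ha : ∀ j, 0 < a j) :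
    IsCompact {x | eval x (ellipsoidQuadratic a) ≤ 0} := by
  refine (isCompact_univ_pi fun j => isCompact_Icc (a := -a j) (b := a j)).of_isClosed_subset
    (isClosed_le (continuous_eval _) continuous_const) fun x hx j _ => ?_
  rw [Set.mem_ofPred_eq, eval_ellipsoidQuadratic, sub_nonpos] at hx
  have hj : ((a j) ^ 2)⁻¹ * x j ^ 2 ≤ 1 :=
    (Finset.single_le_sum (f := fun j => ((a j) ^ 2)⁻¹ * x j ^ 2)
      (fun i _ => by positivity) (Finset.mem_univ j)).trans hx
  rw [inv_mul_le_one₀ (pow_pos (ha j) 2)] at hj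
  exact abs_le.1 (abs_le_of_sq_le_sq hj (ha j).le)

end MvPolynomial

/-- Surjectivity of the map `T : P_m → P_m`, `T(r) = Δ(q·r)`, where
`q(x) = Σ xⱼ²/aⱼ² − 1` is the defining quadratic of an ellipsoid and `P_m` is the space of
real polynomials in `n` variables of degree at most `m`:  for every polynomial `g` of degree
at most `m` there is a polynomial `r` of degree at most `m` with `Δ(q·r) = g`. -/
theorem laplacian_ellipsoid_multiplier_surjective
    (n : ℕ) (hn : 2 ≤ n) (a : Fin n → ℝ) (hpos : ∀ j, 0 < a j)
    (m : ℕ) (g : MvPolynomial (Fin n) ℝ) (hg : g.totalDegree ≤ m) :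
    ∃ r : MvPolynomial (Fin n) ℝ, r.totalDegree ≤ m ∧
      (∑ j, pderiv j (pderiv j
        (((∑ j, C ((a j) ^ 2)⁻¹ * X j ^ 2) - 1) * r))) = g := by
  have hne : Nonempty (Fin n) := ⟨⟨0, by lia⟩⟩
  simp_rw [← laplacian_apply]
  refine exists_laplacian_mul_eq (q := ellipsoidQuadratic a) (totalDegree_ellipsoidQuadratic_le a)
    (fun r hr => ?_) hg
  refine eq_zero_of_laplacian_mul_eq_zero (isCompact_ellipsoid hpos) ⟨0, ?_⟩ (fun x => ?_) hr
  · rw [eval_ellipsoidQuadratic]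
    simp
  · rw [laplacian_ellipsoidQuadratic, eval_C]
    exact Finset.sum_pos (fun j _ => mul_pos two_pos (inv_pos.2 (pow_pos (hpos j) 2)))
      Finset.univ_nonempty
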